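/- (Equivalence of persistence and existence of traveling waves.) Assume (H1) and (H2), and let c≥0. Then the following two statements are equivalent. (1) For every bounded uniformly continuous function u₀:ℝ→[0,∞) with inf_{ξ∈ℝ} u₀(ξ)>0, every bounded classical solution v of (E) on [0,∞) with v(0,·)=u₀, and every K>0, one has liminf_{t→∞} inf_{|ξ|≤K} v(t,ξ) > 0. (2) There exists a bounded positive traveling-wave profile. -/

import Mathlib

open MeasureTheory Real Set Filter Topology

noncomputable section

/-- Hypothesis (H1) on the kernel `k`. -/
def H1 (k : ℝ → ℝ) : Prop :=
  ContDiff ℝ 1 k ∧ (∀ z, 0 ≤ k z) ∧ (∀ z, k (-z) = k z) ∧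
  (∫ z, k z) = 1 ∧ 0 < k 0 ∧
  ∃ μ M : ℝ, 0 < μ ∧ 0 < M ∧ ∀ z, M < |z| →
    k z < Real.exp (-(μ * |z|)) ∧ |deriv k z| < Real.exp (-(μ * |z|))

/-- Hypothesis (EXP): all exponential moments of `k` are finite. -/
def EXPk (k : ℝ → ℝ) : Prop :=
  ∀ μ : ℝ, MeasureTheory.Integrable (fun z => Real.exp (μ * z) * k z)

/-- Hypothesis (H2) on the cut-off function `χ`. -/
def IsH2chi (r q L L0 : ℝ) (χ : ℝ → ℝ) : Prop :=
  0 < r ∧ 0 < q ∧ 0 < L ∧ 0 < L0 ∧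
  ContDiff ℝ 1 χ ∧ (∀ x, χ x ∈ Set.Icc (0:ℝ) 1) ∧
  (∀ x, χ (-x) = χ x) ∧ (∀ x, |x| ≤ L → χ x = 1) ∧
  (∀ x, L + L0 ≤ |x| → χ x = 0) ∧ AntitoneOn χ (Set.Ici 0)

/-- The growth function of hypothesis (H2). -/
def fH2 (r q : ℝ) (χ : ℝ → ℝ) : ℝ → ℝ → ℝ :=
  fun x u => -q + (r * (1 - u) + q) * χ x

/-- A bounded positive traveling-wave profile for speed `c`, kernel `k`, growth `f`. -/
def IsTW (c : ℝ) (k : ℝ → ℝ) (f : ℝ → ℝ → ℝ) (Φ : ℝ → ℝ) : Prop :=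
  ContDiff ℝ 1 Φ ∧ (∀ ξ, 0 < Φ ξ) ∧ (∃ C, ∀ ξ, Φ ξ ≤ C) ∧
  ∀ ξ, c * deriv Φ ξ + ((∫ η, k (η - ξ) * Φ η) - Φ ξ) + f ξ (Φ ξ) * Φ ξ = 0

/-- A bounded classical solution of equation (E) on `[0,∞) × ℝ`, with partial
derivatives `vt` (in time) and `vx` (in space). -/
def IsClassicalSol (c : ℝ) (k : ℝ → ℝ) (f : ℝ → ℝ → ℝ) (v vt vx : ℝ → ℝ → ℝ) : Prop :=
  (∃ C, ∀ t ξ, 0 ≤ t → |v t ξ| ≤ C) ∧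
  ContinuousOn (fun p : ℝ × ℝ => v p.1 p.2) {p : ℝ × ℝ | 0 ≤ p.1} ∧
  ContinuousOn (fun p : ℝ × ℝ => vt p.1 p.2) {p : ℝ × ℝ | 0 ≤ p.1} ∧
  ContinuousOn (fun p : ℝ × ℝ => vx p.1 p.2) {p : ℝ × ℝ | 0 ≤ p.1} ∧
  (∀ t ξ, 0 ≤ t → HasDerivWithinAt (fun s => v s ξ) (vt t ξ) (Set.Ici 0) t) ∧
  (∀ t ξ, 0 ≤ t → HasDerivAt (fun y => v t y) (vx t ξ) ξ) ∧
  (∀ t ξ, 0 ≤ t →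
    vt t ξ = c * vx t ξ + ((∫ η, k (η - ξ) * v t η) - v t ξ) + f ξ (v t ξ) * v t ξ)

/-- The spreading speed `c*` of the homogeneous equation with growth rate `r`. -/
def cstar (k : ℝ → ℝ) (r : ℝ) : ℝ :=
  sInf {y : ℝ | ∃ μ : ℝ, 0 < μ ∧ y = ((∫ z, Real.exp (-(μ * z)) * k z) - 1 + r) / μ}


theorem chain_rule {v vt vx : ℝ → ℝ → ℝ}
    (hvt : ContinuousOn (fun p : ℝ × ℝ => vt p.1 p.2) {p : ℝ × ℝ | 0 ≤ p.1})
    (h1 : ∀ t ξ, 0 ≤ t → HasDerivWithinAt (fun s => v s ξ) (vt t ξ) (Set.Ici 0) t)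
    (h2 : ∀ t ξ, 0 ≤ t → HasDerivAt (fun y => v t y) (vx t ξ) ξ)
    (a y t : ℝ) (ht : 0 ≤ t) :
    HasDerivWithinAt (fun s => v s (y + a * s)) (vt t (y + a * t) + a * vx t (y + a * t))
      (Set.Ici 0) t := by
  have g2 : HasDerivWithinAt (fun s => v t (y + a * s)) (vx t (y + a * t) * a) (Set.Ici 0) t := by
    have hl : HasDerivAt (fun s : ℝ => y + a * s) a t := by
      simpa using ((hasDerivAt_id t).const_mul a).const_add y
    exact ((h2 t (y + a * t) ht).comp t hl).hasDerivWithinAt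
  have g1 : HasDerivWithinAt (fun s => v s (y + a * s) - v t (y + a * s)) (vt t (y + a * t))
      (Set.Ici 0) t := by
    rw [hasDerivWithinAt_iff_isLittleO, Asymptotics.isLittleO_iff]
    intro ε hε
    have hc := hvt (t, y + a * t) ht
    rw [Metric.continuousWithinAt_iff] at hc
    obtain ⟨δ, hδ, hδ'⟩ := hc ε hε
    have hcs : ContinuousAt (fun s : ℝ => y + a * s) t := by fun_prop
    have e1 : ∀ᶠ s in 𝓝[Set.Ici 0] t, dist (y + a * s) (y + a * t) < δ :=
      nhdsWithin_le_nhds (hcs.eventually (Metric.ball_mem_nhds _ hδ))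
    have e2 : ∀ᶠ s in 𝓝[Set.Ici 0] t, dist s t < δ :=
      nhdsWithin_le_nhds (Metric.ball_mem_nhds _ hδ)
    filter_upwards [e1, e2, self_mem_nhdsWithin] with s hs1 hs2 hs3
    have hconv : Convex ℝ (Set.Ici (0:ℝ) ∩ Metric.ball t δ) :=
      (convex_Ici 0).inter (convex_ball t δ)
    have := hconv.norm_image_sub_le_of_norm_hasDerivWithin_le
      (f := fun σ => v σ (y + a * s) - σ * vt t (y + a * t))
      (f' := fun σ => vt σ (y + a * s) - vt t (y + a * t)) (C := ε) (x := t) (y := s)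
      (by
        intro σ hσ
        have := ((h1 σ (y + a * s) hσ.1).mono
          (Set.inter_subset_left (s := Set.Ici (0:ℝ)) (t := Metric.ball t δ))).sub
            ((hasDerivWithinAt_id σ (Set.Ici (0:ℝ) ∩ Metric.ball t δ)).mul_const (vt t (y + a * t)))
        exact this.congr_deriv (by simp))
      (by
        intro σ hσ
        have := hδ' (x := (σ, y + a * s)) hσ.1 (by
          rw [Prod.dist_eq]; exact max_lt hσ.2 hs1)
        rw [Real.dist_eq] at this
        exact this.le)
      ⟨ht, Metric.mem_ball_self hδ⟩ ⟨hs3, hs2⟩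
    refine le_trans (le_of_eq ?_) this
    congr 1
    simp only [smul_eq_mul]
    ring
  have := g1.add g2
  exact (this.congr_deriv (by ring)).congr (fun s _ => by simp) (by simp)

theorem conv_ge {k : ℝ → ℝ} (hk0 : ∀ z, 0 ≤ k z) (hk1 : ∫ z, k z = 1)
    {g : ℝ → ℝ} {m : ℝ} (hm : 0 ≤ m) (hg : ∀ x, -m ≤ g x) (ξ : ℝ) :
    -m ≤ ∫ η, k (η - ξ) * g η := by
  have hki : Integrable k := by
    by_contra h
    rw [integral_undef h] at hk1
    norm_num at hk1
  by_cases hi : Integrable (fun η => k (η - ξ) * g η)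
  · have e : ∫ η, k (η - ξ) * (-m) = -m := by
      rw [integral_mul_const, integral_sub_right_eq_self (fun x => k x), hk1]; ring
    rw [← e]
    exact integral_mono ((hki.comp_sub_right ξ).mul_const _) hi
      (fun η => mul_le_mul_of_nonneg_left (hg η) (hk0 _))
  · rw [integral_undef hi]; linarith

theorem comparison {k : ℝ → ℝ} (hk0 : ∀ z, 0 ≤ k z) (hk1 : ∫ z, k z = 1) {c : ℝ}
    {w D a : ℝ → ℝ → ℝ} {A C : ℝ}
    (hC : ∀ t ξ, 0 ≤ t → |w t ξ| ≤ C) (hA : ∀ t ξ, 0 ≤ t → a t ξ ≤ A)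
    (hd : ∀ y t, 0 ≤ t →
      HasDerivWithinAt (fun s => w s (y + -c * s)) (D t (y + -c * t)) (Set.Ici 0) t)
    (hD : ∀ t ξ, 0 ≤ t → (∫ η, k (η - ξ) * w t η) + a t ξ * w t ξ ≤ D t ξ)
    (h0 : ∀ ξ, 0 ≤ w 0 ξ) : ∀ t ξ, 0 ≤ t → 0 ≤ w t ξ := by
  set l := |A| + 3 with hl
  have hA' : A ≤ |A| := le_abs_self A
  have step : ∀ m : ℝ, 0 < m → (∀ t ξ, 0 ≤ t → -(m * exp (l * t)) ≤ w t ξ) →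
      (∀ t ξ, 0 ≤ t → -(m / 2 * exp (l * t)) ≤ w t ξ) := by
    intro m hm hP t1 ξ1 ht1
    have key := image_le_of_deriv_right_lt_deriv_boundary (a := 0) (b := t1)
      (f := fun s => -w s (ξ1 + c * t1 + -c * s)) (f' := fun s => -D s (ξ1 + c * t1 + -c * s))
      (B := fun s => m / 2 * exp (l * s)) (B' := fun s => m / 2 * (exp (l * s) * l))
      (by
        intro s hs
        exact ((hd (ξ1 + c * t1) s hs.1).continuousWithinAt.neg).mono (fun x hx => hx.1))
      (by
        intro s hs
        exact (hd (ξ1 + c * t1) s hs.1).neg.mono (Set.Ici_subset_Ici.2 hs.1))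
      (by
        have := h0 (ξ1 + c * t1 + -c * 0)
        have h2 : 0 < m / 2 * exp (l * 0) := by positivity
        linarith)
      (by
        intro s
        have : HasDerivAt (fun s : ℝ => l * s) l s := by
          simpa using (hasDerivAt_id s).const_mul l
        exact (this.exp).const_mul _)
      (by
        intro s hs heq
        have hs0 := hs.1
        set ξ := ξ1 + c * t1 + -c * s
        have h1 := hD s ξ hs0
        have h2 := conv_ge hk0 hk1 (g := w s) (m := m * exp (l * s)) (by positivity)
          (fun x => hP s x hs0) ξ
        have h3 := hA s ξ hs0
        have hw : w s ξ = -(m / 2 * exp (l * s)) := by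
          have : -w s ξ = m / 2 * exp (l * s) := heq
          linarith
        have hE : 0 < m / 2 * exp (l * s) := by positivity
        set E := m / 2 * exp (l * s)
        rw [hw] at h1
        have h4 : a s ξ * E ≤ A * E := mul_le_mul_of_nonneg_right h3 hE.le
        have h5 : A * E ≤ |A| * E := mul_le_mul_of_nonneg_right hA' hE.le
        have h6 : m / 2 * (exp (l * s) * l) = |A| * E + 3 * E := by
          rw [hl]; ring
        have h7 : m * exp (l * s) = 2 * E := by simp only [E]; ring
        show -D s ξ < m / 2 * (exp (l * s) * l)
        rw [h6]; rw [h7] at h2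
        nlinarith)
    have := key (x := t1) ⟨ht1, le_refl _⟩
    have e : ξ1 + c * t1 + -c * t1 = ξ1 := by ring
    rw [e] at this
    linarith
  have it : ∀ n : ℕ, ∀ t ξ, 0 ≤ t → -((|C| + 1) * (1 / 2) ^ n * exp (l * t)) ≤ w t ξ := by
    intro n
    induction n with
    | zero =>
      intro t ξ ht
      have h1 := hC t ξ ht
      have h2 : 1 ≤ exp (l * t) := by
        apply Real.one_le_exp
        have : 0 ≤ l := by positivity
        positivity
      have h3 := neg_abs_le (w t ξ)
      have h4 := le_abs_self C
      have h5 := abs_nonneg C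
      simp only [pow_zero, mul_one]
      nlinarith
    | succ n ih =>
      intro t ξ ht
      have := step _ (by positivity) ih t ξ ht
      refine le_trans (le_of_eq ?_) this
      rw [pow_succ]; ring
  intro t ξ ht
  have lim : Tendsto (fun n : ℕ => -((|C| + 1) * (1 / 2 : ℝ) ^ n * exp (l * t))) atTop (𝓝 0) := by
    have h := tendsto_pow_atTop_nhds_zero_of_lt_one (r := (1/2:ℝ)) (by norm_num) (by norm_num)
    have h2 := ((h.const_mul (|C| + 1)).mul_const (exp (l * t))).neg
    simpa using h2
  exact le_of_tendsto' lim (fun n => it n t ξ ht)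

/-- measurable bounded functions integrate against the kernel -/
theorem conv_integrable {k : ℝ → ℝ} (hki : Integrable k) {g : ℝ → ℝ} {C : ℝ}
    (hg : AEStronglyMeasurable g volume) (hC : ∀ x, |g x| ≤ C) (ξ : ℝ) :
    Integrable (fun η => k (η - ξ) * g η) := by
  exact (hki.comp_sub_right ξ).mul_bdd (c := C) hg (Eventually.of_forall hC)

theorem k_integrable {k : ℝ → ℝ} (hk1 : ∫ z, k z = 1) : Integrable k := by
  by_contra h
  rw [integral_undef h] at hk1
  norm_num at hk1

theorem slice_cont {v : ℝ → ℝ → ℝ}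
    (h2 : ContinuousOn (fun p : ℝ × ℝ => v p.1 p.2) {p : ℝ × ℝ | 0 ≤ p.1}) (t : ℝ) (ht : 0 ≤ t) :
    Continuous (v t) := by
  have : Continuous ((fun p : ℝ × ℝ => v p.1 p.2) ∘ fun x : ℝ => (t, x)) :=
    h2.comp_continuous (by fun_prop) (fun x => ht)
  exact this

theorem dir21 (k : ℝ → ℝ) (hk : H1 k)
    (r q L L0 : ℝ) (χ : ℝ → ℝ) (hχ : IsH2chi r q L L0 χ)
    (c : ℝ) (Φ : ℝ → ℝ) (hΦ : IsTW c k (fH2 r q χ) Φ) :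
    (∀ u₀ : ℝ → ℝ, UniformContinuous u₀ → (∃ C, ∀ ξ, u₀ ξ ≤ C) → (∀ ξ, 0 ≤ u₀ ξ) →
        (∃ δ > 0, ∀ ξ, δ ≤ u₀ ξ) →
        ∀ v vt vx, IsClassicalSol c k (fH2 r q χ) v vt vx → (∀ ξ, v 0 ξ = u₀ ξ) →
          ∀ K > 0, ∃ δ > 0, ∃ T : ℝ, ∀ t ≥ T, ∀ ξ : ℝ, |ξ| ≤ K → δ ≤ v t ξ) := by
  intro u₀ _ _ _ ⟨δ, hδ, hδu⟩ v vt vx ⟨⟨Cv, hCv⟩, hv, hvt, hvx, hdt, hdx, heq⟩ hv0 K hK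
  obtain ⟨hΦ1, hΦpos, ⟨M, hM⟩, hΦeq⟩ := hΦ
  obtain ⟨-, hk0, -, hk1, -, -⟩ := hk
  obtain ⟨hr, hq, -, -, hχ1, hχ01, -, -, -, -⟩ := hχ
  have hki := k_integrable hk1
  have hM0 : 0 < M := lt_of_lt_of_le (hΦpos 0) (hM 0)
  have hΦabs : ∀ x, |Φ x| ≤ M := fun x => by rw [abs_of_pos (hΦpos x)]; exact hM x
  obtain ⟨ε, hε, hε1, hεM⟩ : ∃ ε : ℝ, 0 < ε ∧ ε ≤ 1 ∧ ε * M ≤ δ := by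
    refine ⟨min 1 (δ / M), by positivity, min_le_left _ _, ?_⟩
    calc min 1 (δ / M) * M ≤ δ / M * M := by gcongr; exact min_le_right _ _
      _ = δ := by field_simp
  have hdΦ : ∀ y t : ℝ, HasDerivAt (fun s : ℝ => ε * Φ (y + -c * s))
      (ε * (deriv Φ (y + -c * t) * -c)) t := by
    intro y t
    have hl : HasDerivAt (fun s : ℝ => y + -c * s) (-c) t := by
      simpa using ((hasDerivAt_id t).const_mul (-c)).const_add y
    have h1 := (hΦ1.differentiable (by norm_num) (y + -c * t)).hasDerivAt
    exact (h1.comp t hl).const_mul ε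
  have cmp := comparison (k := k) (c := c) hk0 hk1 (w := fun t ξ => v t ξ - ε * Φ ξ)
    (D := fun t ξ => vt t ξ + -c * vx t ξ - ε * (deriv Φ ξ * -c))
    (a := fun t ξ => -1 + (-q + (r + q) * χ ξ - r * χ ξ * (v t ξ + ε * Φ ξ)))
    (A := q + (r + q) + r * (Cv + M)) (C := Cv + M)
    (by
      intro t ξ ht
      have h1 := hCv t ξ ht
      have h2 := hΦpos ξ
      have h3 := hM ξ
      rw [abs_le] at h1 ⊢
      constructor <;> nlinarith)
    (by
      intro t ξ ht
      have h1 := abs_le.1 (hCv t ξ ht)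
      have h2 := hΦpos ξ
      have h3 := hM ξ
      have h4 := hχ01 ξ
      have h5 : 0 ≤ r * χ ξ := mul_nonneg hr.le h4.1
      have h6 : r * χ ξ ≤ r := by nlinarith [h4.2]
      have h7 : (r + q) * χ ξ ≤ r + q := by nlinarith [h4.2]
      have h8 : 0 ≤ ε * Φ ξ := by positivity
      have h9 : -(r * χ ξ * (v t ξ + ε * Φ ξ)) ≤ r * χ ξ * (Cv + M) := by
        have : -(v t ξ + ε * Φ ξ) ≤ Cv + M := by linarith
        nlinarith
      have h10 : r * χ ξ * (Cv + M) ≤ r * (Cv + M) :=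
        mul_le_mul_of_nonneg_right h6 (by linarith [h1.1, h1.2])
      linarith)
    (by
      intro y t ht
      exact (chain_rule hvt hdt hdx (-c) y t ht).sub (hdΦ y t).hasDerivWithinAt)
    (by
      intro t ξ ht
      have e1 := heq t ξ ht
      have e2 := hΦeq ξ
      have i1 := conv_integrable hki (g := v t) (slice_cont hv t ht).aestronglyMeasurable
        (fun x => hCv t x ht) ξ
      have i2 := conv_integrable hki (g := Φ) hΦ1.continuous.aestronglyMeasurable hΦabs ξ
      have i3 : ∫ η, k (η - ξ) * (v t η - ε * Φ η) =
          (∫ η, k (η - ξ) * v t η) - ε * ∫ η, k (η - ξ) * Φ η := by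
        rw [← integral_const_mul, ← integral_sub i1 (i2.const_mul ε)]
        congr 1; ext η; ring
      rw [i3]
      unfold fH2 at e1 e2
      have h2 := hΦpos ξ
      have h4 := (hχ01 ξ).1
      have h5 : 0 ≤ ε * Φ ξ * (r * χ ξ) * (Φ ξ - ε * Φ ξ) := by
        have : 0 ≤ Φ ξ - ε * Φ ξ := by nlinarith
        positivity
      have e2' : ε * (c * deriv Φ ξ) = - ε * ((∫ η, k (η - ξ) * Φ η) - Φ ξ)
        - ε * ((-q + (r * (1 - Φ ξ) + q) * χ ξ) * Φ ξ) := by linear_combination ε * e2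
      rw [e1]
      nlinarith)
    (by
      intro ξ
      have h1 := hδu ξ
      have h2 := hM ξ
      simp only [hv0]
      nlinarith)
  have hcomp : IsCompact (Set.Icc (-K) K) := isCompact_Icc
  obtain ⟨x0, hx0, hmin⟩ := hcomp.exists_isMinOn ⟨0, by constructor <;> linarith⟩
    hΦ1.continuous.continuousOn
  refine ⟨ε * Φ x0, mul_pos hε (hΦpos x0), 0, ?_⟩
  intro t ht ξ hξ
  have h1 := cmp t ξ ht
  have h2 : Φ x0 ≤ Φ ξ := hmin (abs_le.1 hξ)
  nlinarith


theorem integrable_exp_abs {μ : ℝ} (hμ : 0 < μ) : Integrable (fun z : ℝ => exp (-(μ * |z|))) := by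
  have hc : Continuous (fun z : ℝ => exp (-(μ * |z|))) := by fun_prop
  refine hc.locallyIntegrable.integrable_of_isBigO_atTop_of_norm_isNegInvariant
    (g := fun z : ℝ => exp (-(μ * |z|))) ?_ (Asymptotics.isBigO_refl _ _) ?_
  · exact Eventually.of_forall (fun z => by simp)
  · refine ⟨Set.Ioi 0, Ioi_mem_atTop 0, ?_⟩
    refine (exp_neg_integrableOn_Ioi 0 hμ).congr_fun (fun x hx => ?_) measurableSet_Ioi
    simp only
    rw [abs_of_pos hx]; ring_nf

theorem deriv_k_bound {k : ℝ → ℝ} (hk : H1 k) :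
    ∃ μ C : ℝ, 0 < μ ∧ 0 ≤ C ∧ ∀ z, |deriv k z| ≤ C * exp (-(μ * |z|)) := by
  obtain ⟨hk1, -, -, -, -, μ, M, hμ, hM, h⟩ := hk
  have hcont : Continuous (deriv k) := hk1.continuous_deriv (by norm_num)
  obtain ⟨B, hB⟩ := (isCompact_Icc (a := -M) (b := M)).exists_bound_of_continuousOn
    hcont.continuousOn
  have hB0 : 0 ≤ B := le_trans (norm_nonneg _) (hB 0 ⟨by linarith, hM.le⟩)
  refine ⟨μ, B * exp (μ * M) + 1, hμ, by positivity, fun z => ?_⟩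
  by_cases hz : M < |z|
  · have := (h z hz).2
    have h2 : 0 ≤ B * exp (μ * M) * exp (-(μ * |z|)) := by positivity
    linarith
  · push Not at hz
    have h1 := hB z (abs_le.1 hz)
    rw [Real.norm_eq_abs] at h1
    have h2 : 1 ≤ exp (μ * M) * exp (-(μ * |z|)) := by
      rw [← Real.exp_add]; apply Real.one_le_exp
      nlinarith
    have h3 : 0 < exp (-(μ * |z|)) := exp_pos _
    nlinarith

theorem deriv_k_integrable {k : ℝ → ℝ} (hk : H1 k) : Integrable (deriv k) := by
  obtain ⟨μ, C, hμ, hC, hb⟩ := deriv_k_bound hk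
  have hcont : Continuous (deriv k) := hk.1.continuous_deriv (by norm_num)
  exact ((integrable_exp_abs hμ).const_mul C).mono' hcont.aestronglyMeasurable
    (Eventually.of_forall hb)

theorem conv_deriv {k : ℝ → ℝ} (hk : H1 k) {g : ℝ → ℝ} {C : ℝ}
    (hg : AEStronglyMeasurable g volume) (hC : ∀ x, |g x| ≤ C) (ξ : ℝ) :
    HasDerivAt (fun ξ => ∫ η, k (η - ξ) * g η) (∫ η, (-deriv k (η - ξ)) * g η) ξ := by
  obtain ⟨μ, B, hμ, hB, hb⟩ := deriv_k_bound hk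
  have hcont : Continuous (deriv k) := hk.1.continuous_deriv (by norm_num)
  have hkc : Continuous k := hk.1.continuous
  have hki := k_integrable hk.2.2.2.1
  have hC0 : 0 ≤ C := le_trans (abs_nonneg _) (hC 0)
  refine (hasDerivAt_integral_of_dominated_loc_of_deriv_le (μ := volume)
    (F := fun ξ η => k (η - ξ) * g η)
    (F' := fun ξ η => (-deriv k (η - ξ)) * g η) (s := Metric.ball ξ 1)
    (bound := fun η => (B * exp μ * C) * exp (-(μ * |η - ξ|)))
    (Metric.ball_mem_nhds ξ one_pos) ?_ ?_ ?_ ?_ ?_ ?_).2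
  · exact Eventually.of_forall fun x =>
      (conv_integrable hki hg hC x).aestronglyMeasurable
  · exact conv_integrable hki hg hC ξ
  · exact ((hcont.comp (by fun_prop : Continuous fun η => η - ξ)).neg.aestronglyMeasurable).mul hg
  · refine Eventually.of_forall fun η x hx => ?_
    rw [norm_mul, norm_neg, Real.norm_eq_abs, Real.norm_eq_abs]
    have h1 := hb (η - x)
    have h2 : exp (-(μ * |η - x|)) ≤ exp μ * exp (-(μ * |η - ξ|)) := by
      rw [← Real.exp_add]
      apply Real.exp_le_exp.2
      have hx' : |x - ξ| < 1 := by simpa [Real.dist_eq] using hx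
      have h3 : |η - ξ| ≤ |η - x| + |x - ξ| := abs_sub_le _ _ _
      nlinarith
    calc |deriv k (η - x)| * |g η| ≤ (B * exp (-(μ * |η - x|))) * C := by
          gcongr
          exact hC η
      _ ≤ (B * (exp μ * exp (-(μ * |η - ξ|)))) * C := by gcongr
      _ = _ := by ring
  · exact ((integrable_exp_abs hμ).comp_sub_right ξ).const_mul _
  · refine Eventually.of_forall fun η x _ => ?_
    have hl : HasDerivAt (fun x : ℝ => η - x) (-1) x := by
      simpa using (hasDerivAt_id x).const_sub η
    have h1 := (hk.1.differentiable (by norm_num) (η - x)).hasDerivAt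
    exact ((h1.comp x hl).mul_const (g η)).congr_deriv (by ring)

theorem conv_cont {j : ℝ → ℝ} (hj : Integrable j) {P : ℝ → ℝ → ℝ} {C : ℝ}
    (hP : Continuous (fun p : ℝ × ℝ => P p.1 p.2)) (hC : ∀ t x, |P t x| ≤ C) :
    Continuous (fun p : ℝ × ℝ => ∫ η, j (η - p.2) * P p.1 η) := by
  have e : ∀ p : ℝ × ℝ, ∫ η, j (η - p.2) * P p.1 η = ∫ z, j z * P p.1 (z + p.2) := by
    intro p
    rw [← integral_add_right_eq_self (fun η => j (η - p.2) * P p.1 η) p.2]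
    simp
  simp_rw [e]
  have hP2 : ∀ z : ℝ, Continuous fun p : ℝ × ℝ => P p.1 (z + p.2) := fun z =>
    hP.comp (by fun_prop : Continuous fun p : ℝ × ℝ => (p.1, z + p.2))
  have hP3 : ∀ p : ℝ × ℝ, Continuous fun z : ℝ => P p.1 (z + p.2) := fun p =>
    hP.comp (by fun_prop : Continuous fun z : ℝ => (p.1, z + p.2))
  refine continuous_of_dominated (bound := fun z => |j z| * C) ?_ ?_ ?_ ?_
  · intro p
    exact hj.aestronglyMeasurable.mul (hP3 p).aestronglyMeasurable
  · intro p
    refine Eventually.of_forall fun z => ?_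
    rw [norm_mul, Real.norm_eq_abs, Real.norm_eq_abs]
    gcongr
    exact hC _ _
  · exact hj.abs.mul_const C
  · exact Eventually.of_forall fun z => continuous_const.mul (hP2 z)


def clp (u : ℝ) : ℝ := max 0 (min 1 u)
def Hf (r q : ℝ) (χ : ℝ → ℝ) (x u : ℝ) : ℝ := (q + r) * u + fH2 r q χ x u * u
def Nf (c : ℝ) (k : ℝ → ℝ) (r q : ℝ) (χ : ℝ → ℝ) (P : ℝ → ℝ → ℝ) (s y : ℝ) : ℝ :=
  (∫ η, k (η - y) * P s η) + Hf r q χ (y + -c * s) (P s y)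
def Jf (l : ℝ) (N : ℝ → ℝ → ℝ) (t y : ℝ) : ℝ := 1 + ∫ s in (0:ℝ)..t, exp (l * s) * N s y

theorem clp_nonneg (u : ℝ) : 0 ≤ clp u := le_max_left _ _
theorem clp_le (u : ℝ) : clp u ≤ 1 := max_le zero_le_one (min_le_left _ _)
theorem clp_cont : Continuous clp := by unfold clp; fun_prop
theorem clp_eq {u : ℝ} (h0 : 0 ≤ u) (h1 : u ≤ 1) : clp u = u := by
  unfold clp; rw [min_eq_right h1, max_eq_right h0]
theorem clp_lip (u v : ℝ) : |clp u - clp v| ≤ |u - v| := by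
  unfold clp
  refine (abs_max_sub_max_le_max _ _ _ _).trans ?_
  simp only [sub_self, abs_zero]
  refine max_le (abs_nonneg _) ((abs_min_sub_min_le_max _ _ _ _).trans ?_)
  simp

theorem conv_abs {k : ℝ → ℝ} (hk0 : ∀ z, 0 ≤ k z) (hk1 : ∫ z, k z = 1)
    {g : ℝ → ℝ} {m : ℝ} (hg : ∀ x, |g x| ≤ m) (ξ : ℝ) :
    |∫ η, k (η - ξ) * g η| ≤ m := by
  have hm : 0 ≤ m := le_trans (abs_nonneg _) (hg 0)
  have h1 := conv_ge hk0 hk1 (g := g) hm (fun x => (abs_le.1 (hg x)).1) ξ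
  have h2 := conv_ge hk0 hk1 (g := fun x => -g x) hm (fun x => by linarith [(abs_le.1 (hg x)).2]) ξ
  simp only [mul_neg, integral_neg] at h2
  rw [abs_le]; constructor <;> linarith

section
variable {k : ℝ → ℝ} {r q L L0 : ℝ} {χ : ℝ → ℝ}

theorem Hf_bounds (hχ : IsH2chi r q L L0 χ) (x : ℝ) {u : ℝ} (h0 : 0 ≤ u) (h1 : u ≤ 1) :
    0 ≤ Hf r q χ x u ∧ Hf r q χ x u ≤ q + r := by
  obtain ⟨hr, hq, -, -, -, hχ01, -⟩ := hχ
  obtain ⟨ha, hb⟩ := hχ01 x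
  unfold Hf fH2
  set z := χ x
  have e : (q + r) * u + (-q + (r * (1 - u) + q) * z) * u =
    r * u + r * u * z * (1 - u) + q * z * u := by ring
  rw [e]
  have hu : 0 ≤ 1 - u := by linarith
  have hz : 0 ≤ 1 - z := by linarith
  constructor
  · positivity
  · have e1 : r * u * z * (1 - u) ≤ r * (1 - u) := by
      have : u * z ≤ 1 := by nlinarith
      have h3 : 0 ≤ r * (1 - u) := by positivity
      nlinarith
    have e2 : q * z * u ≤ q := by
      have : z * u ≤ 1 := by nlinarith
      nlinarith
    nlinarith

theorem Hf_lip (hχ : IsH2chi r q L L0 χ) (x : ℝ) {u v : ℝ} (h0 : 0 ≤ u) (h1 : u ≤ 1)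
    (h2 : 0 ≤ v) (h3 : v ≤ 1) :
    |Hf r q χ x u - Hf r q χ x v| ≤ (2 * r + q) * |u - v| := by
  obtain ⟨hr, hq, -, -, -, hχ01, -⟩ := hχ
  obtain ⟨ha, hb⟩ := hχ01 x
  unfold Hf fH2
  set z := χ x
  have e : (q + r) * u + (-q + (r * (1 - u) + q) * z) * u
      - ((q + r) * v + (-q + (r * (1 - v) + q) * z) * v) =
    (r + (r + q) * z - r * z * (u + v)) * (u - v) := by ring
  rw [e, abs_mul]
  refine mul_le_mul_of_nonneg_right ?_ (abs_nonneg _)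
  rw [abs_le]
  have hrz : 0 ≤ r * z := by positivity
  have hrz1 : r * z ≤ r := by nlinarith
  have hqz : 0 ≤ q * z := by positivity
  have hqz1 : q * z ≤ q := by nlinarith
  constructor <;> nlinarith

theorem Nf_cont (hk : H1 k) (hχ : IsH2chi r q L L0 χ) (c : ℝ) {P : ℝ → ℝ → ℝ}
    (hP : Continuous (fun p : ℝ × ℝ => P p.1 p.2)) (hP0 : ∀ t x, 0 ≤ P t x)
    (hP1 : ∀ t x, P t x ≤ 1) :
    Continuous (fun p : ℝ × ℝ => Nf c k r q χ P p.1 p.2) := by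
  have hki := k_integrable hk.2.2.2.1
  have h1 := conv_cont hki hP (C := 1) (fun t x => by rw [abs_of_nonneg (hP0 t x)]; exact hP1 t x)
  have hχc : Continuous χ := hχ.2.2.2.2.1.continuous
  unfold Nf Hf fH2
  refine h1.add ?_
  have h2 : Continuous fun p : ℝ × ℝ => χ (p.2 + -c * p.1) := hχc.comp (by fun_prop)
  fun_prop

theorem Nf_bounds (hk : H1 k) (hχ : IsH2chi r q L L0 χ) (c : ℝ) {P : ℝ → ℝ → ℝ}
    (hP0 : ∀ t x, 0 ≤ P t x)
    (hP1 : ∀ t x, P t x ≤ 1) (s y : ℝ) :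
    0 ≤ Nf c k r q χ P s y ∧ Nf c k r q χ P s y ≤ 1 + q + r := by
  have h1 := conv_ge hk.2.1 hk.2.2.2.1 (g := P s) le_rfl (fun x => by simpa using hP0 s x) y
  have h2 := conv_abs hk.2.1 hk.2.2.2.1 (g := P s) (m := 1)
    (fun x => by rw [abs_of_nonneg (hP0 s x)]; exact hP1 s x) y
  have h3 := Hf_bounds hχ (y + -c * s) (hP0 s y) (hP1 s y)
  have h4 := (abs_le.1 h2).2
  unfold Nf
  constructor <;> linarith

theorem Nf_lip (hk : H1 k) (hχ : IsH2chi r q L L0 χ) (c : ℝ) {P Q : ℝ → ℝ → ℝ}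
    (hP : Continuous (fun p : ℝ × ℝ => P p.1 p.2)) (hP0 : ∀ t x, 0 ≤ P t x)
    (hP1 : ∀ t x, P t x ≤ 1)
    (hQ : Continuous (fun p : ℝ × ℝ => Q p.1 p.2)) (hQ0 : ∀ t x, 0 ≤ Q t x)
    (hQ1 : ∀ t x, Q t x ≤ 1) (s y m : ℝ) (hm : ∀ x, |P s x - Q s x| ≤ m) :
    |Nf c k r q χ P s y - Nf c k r q χ Q s y| ≤ (1 + 2 * r + q) * m := by
  have hki := k_integrable hk.2.2.2.1
  have hPs : Continuous (P s) := hP.comp (by fun_prop : Continuous fun x : ℝ => (s, x))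
  have hQs : Continuous (Q s) := hQ.comp (by fun_prop : Continuous fun x : ℝ => (s, x))
  have i1 := conv_integrable hki hPs.aestronglyMeasurable (C := 1)
    (fun x => by rw [abs_of_nonneg (hP0 s x)]; exact hP1 s x) y
  have i2 := conv_integrable hki hQs.aestronglyMeasurable (C := 1)
    (fun x => by rw [abs_of_nonneg (hQ0 s x)]; exact hQ1 s x) y
  have h2 := conv_abs hk.2.1 hk.2.2.2.1 (g := fun x => P s x - Q s x) hm y
  have h3 := Hf_lip hχ (y + -c * s) (hP0 s y) (hP1 s y) (hQ0 s y) (hQ1 s y)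
  simp only [mul_sub] at h2
  rw [integral_sub i1 i2] at h2
  have h5 : (2 * r + q) * |P s y - Q s y| ≤ (2 * r + q) * m :=
    mul_le_mul_of_nonneg_left (hm y) (by linarith [hχ.1, hχ.2.1])
  unfold Nf
  rw [add_sub_add_comm]
  refine (abs_add_le _ _).trans ?_
  linarith
end

theorem Jf_cont {N : ℝ → ℝ → ℝ} (hN : Continuous (fun p : ℝ × ℝ => N p.1 p.2)) (l : ℝ) :
    Continuous (fun p : ℝ × ℝ => Jf l N p.1 p.2) := by
  unfold Jf
  refine continuous_const.add ?_
  refine intervalIntegral.continuous_parametric_intervalIntegral_of_continuous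
    (f := fun (p : ℝ × ℝ) s => exp (l * s) * N s p.2) ?_ continuous_fst
  have : Continuous fun x : (ℝ × ℝ) × ℝ => N x.2 x.1.2 :=
    hN.comp (by fun_prop : Continuous fun x : (ℝ × ℝ) × ℝ => (x.2, x.1.2))
  unfold Function.uncurry
  fun_prop

theorem int_exp (l t : ℝ) :
    ∫ s in (0:ℝ)..t, exp (l * s) * l = exp (l * t) - 1 := by
  have h : ∀ s ∈ Set.uIcc 0 t, HasDerivAt (fun s => exp (l * s)) (exp (l * s) * l) s := by
    intro s _
    have : HasDerivAt (fun s : ℝ => l * s) l s := by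
      simpa using (hasDerivAt_id s).const_mul l
    exact this.exp
  rw [intervalIntegral.integral_eq_sub_of_hasDerivAt h
    (Continuous.intervalIntegrable (by fun_prop) _ _)]
  simp

theorem N_slice {N : ℝ → ℝ → ℝ} (hN : Continuous (fun p : ℝ × ℝ => N p.1 p.2)) (l y : ℝ) :
    Continuous fun s => exp (l * s) * N s y := by
  have : Continuous fun s => N s y := hN.comp (by fun_prop : Continuous fun s : ℝ => (s, y))
  fun_prop

theorem Jf_bounds {N : ℝ → ℝ → ℝ} (hN : Continuous (fun p : ℝ × ℝ => N p.1 p.2)) {l : ℝ}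
    (h0 : ∀ s y, 0 ≤ N s y) (h1 : ∀ s y, N s y ≤ l) {t : ℝ} (ht : 0 ≤ t) (y : ℝ) :
    0 ≤ Jf l N t y ∧ Jf l N t y ≤ exp (l * t) := by
  unfold Jf
  constructor
  · have : 0 ≤ ∫ s in (0:ℝ)..t, exp (l * s) * N s y :=
      intervalIntegral.integral_nonneg ht (fun s _ => mul_nonneg (exp_pos _).le (h0 s y))
    linarith
  · have : ∫ s in (0:ℝ)..t, exp (l * s) * N s y ≤ ∫ s in (0:ℝ)..t, exp (l * s) * l :=
      intervalIntegral.integral_mono_on ht ((N_slice hN l y).intervalIntegrable _ _)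
        (Continuous.intervalIntegrable (by fun_prop) _ _)
        (fun s _ => mul_le_mul_of_nonneg_left (h1 s y) (exp_pos _).le)
    rw [int_exp] at this
    linarith

theorem Jf_lip {N N' : ℝ → ℝ → ℝ} (hN : Continuous (fun p : ℝ × ℝ => N p.1 p.2))
    (hN' : Continuous (fun p : ℝ × ℝ => N' p.1 p.2)) {l ρ m : ℝ}
    (hm : 0 ≤ m)
    (h : ∀ s y, 0 ≤ s → |N s y - N' s y| ≤ ρ * m * exp ((ρ - l) * s)) {t : ℝ} (ht : 0 ≤ t) (y : ℝ) :
    |Jf l N t y - Jf l N' t y| ≤ m * exp (ρ * t) := by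
  unfold Jf
  rw [add_sub_add_left_eq_sub, ← intervalIntegral.integral_sub
    ((N_slice hN l y).intervalIntegrable _ _) ((N_slice hN' l y).intervalIntegrable _ _)]
  have : ‖∫ s in (0:ℝ)..t, (exp (l * s) * N s y - exp (l * s) * N' s y)‖ ≤
      ∫ s in (0:ℝ)..t, m * (exp (ρ * s) * ρ) := by
    refine intervalIntegral.norm_integral_le_of_norm_le ht (Eventually.of_forall fun s hs => ?_)
      (Continuous.intervalIntegrable (by fun_prop) _ _)
    rw [← mul_sub, Real.norm_eq_abs, abs_mul, abs_of_pos (exp_pos _)]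
    have h1 := h s y hs.1.le
    have h2 : exp (ρ * s) = exp (l * s) * exp ((ρ - l) * s) := by
      rw [← Real.exp_add]; ring_nf
    calc exp (l * s) * |N s y - N' s y| ≤ exp (l * s) * (ρ * m * exp ((ρ - l) * s)) := by gcongr
      _ = _ := by rw [h2]; ring
  rw [Real.norm_eq_abs, intervalIntegral.integral_const_mul, int_exp] at this
  nlinarith

theorem Jf_deriv {N : ℝ → ℝ → ℝ} (hN : Continuous (fun p : ℝ × ℝ => N p.1 p.2)) (l t y : ℝ) :
    HasDerivAt (fun t => exp (-(l * t)) * Jf l N t y)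
      (-l * (exp (-(l * t)) * Jf l N t y) + N t y) t := by
  have h1 : HasDerivAt (fun t => Jf l N t y) (exp (l * t) * N t y) t := by
    unfold Jf
    refine HasDerivAt.const_add 1 ?_
    exact intervalIntegral.integral_hasDerivAt_right ((N_slice hN l y).intervalIntegrable _ _)
      (N_slice hN l y).stronglyMeasurable.stronglyMeasurableAtFilter
      (N_slice hN l y).continuousAt
  have h2 : HasDerivAt (fun t : ℝ => exp (-(l * t))) (exp (-(l * t)) * -l) t := by
    have : HasDerivAt (fun s : ℝ => -(l * s)) (-l) t := by
      exact ((hasDerivAt_id t).const_mul l).neg.congr_deriv (by simp)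
    exact this.exp
  refine (h2.mul h1).congr_deriv ?_
  have : exp (-(l * t)) * exp (l * t) = 1 := by rw [← Real.exp_add]; simp
  linear_combination (N t y) * this

theorem exists_W {k : ℝ → ℝ} {r q L L0 : ℝ} {χ : ℝ → ℝ} (hk : H1 k) (hχ : IsH2chi r q L L0 χ)
    (c : ℝ) : ∃ W : ℝ → ℝ → ℝ, Continuous (fun p : ℝ × ℝ => W p.1 p.2) ∧
      (∀ t y, 0 ≤ W t y) ∧ (∀ t y, W t y ≤ 1) ∧ (∀ y, W 0 y = 1) ∧
      ∀ y t, 0 ≤ t → HasDerivWithinAt (fun s => W s y)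
        ((∫ η, k (η - y) * W t η) - W t y + fH2 r q χ (y + -c * t) (W t y) * W t y)
        (Set.Ici 0) t := by
  have hr := hχ.1
  have hq := hχ.2.1
  set l := 1 + q + r with hl
  have hl0 : 0 < l := by positivity
  set ρ := 2 * (1 + 2 * r + q) with hρ
  have hρ0 : 0 < ρ := by positivity
  have hρl : l ≤ ρ := by rw [hl, hρ]; linarith
  let X := BoundedContinuousFunction (ℝ × ℝ) ℝ
  let P : X → ℝ → ℝ → ℝ := fun Z t y => clp (exp ((ρ - l) * t) * Z (t, y))
  have hPc : ∀ Z, Continuous (fun p : ℝ × ℝ => P Z p.1 p.2) := fun Z =>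
    clp_cont.comp (by fun_prop)
  have hP0 : ∀ Z t y, 0 ≤ P Z t y := fun Z t y => clp_nonneg _
  have hP1 : ∀ Z t y, P Z t y ≤ 1 := fun Z t y => clp_le _
  let N : X → ℝ → ℝ → ℝ := fun Z => Nf c k r q χ (P Z)
  have hNc : ∀ Z, Continuous (fun p : ℝ × ℝ => N Z p.1 p.2) := fun Z =>
    Nf_cont hk hχ c (hPc Z) (hP0 Z) (hP1 Z)
  have hNb : ∀ Z s y, 0 ≤ N Z s y ∧ N Z s y ≤ l := fun Z => Nf_bounds hk hχ c (hP0 Z) (hP1 Z)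
  have hJb : ∀ Z t y, 0 ≤ t → 0 ≤ Jf l (N Z) t y ∧ Jf l (N Z) t y ≤ exp (l * t) := fun Z t y ht =>
    Jf_bounds (hNc Z) (fun s y => (hNb Z s y).1) (fun s y => (hNb Z s y).2) ht y
  have hJc : ∀ Z, Continuous (fun p : ℝ × ℝ => Jf l (N Z) (max p.1 0) p.2) := fun Z =>
    (Jf_cont (hNc Z) l).comp (by fun_prop : Continuous fun p : ℝ × ℝ => (max p.1 0, p.2))
  let T : X → X := fun Z => BoundedContinuousFunction.ofNormedAddCommGroup
    (fun p : ℝ × ℝ => exp (-(ρ * max p.1 0)) * Jf l (N Z) (max p.1 0) p.2)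
    (by have := hJc Z; fun_prop) 1 (by
      rintro ⟨t, y⟩
      have ht : 0 ≤ max t 0 := le_max_right _ _
      have h := hJb Z (max t 0) y ht
      rw [Real.norm_eq_abs, abs_of_nonneg (mul_nonneg (exp_pos _).le h.1)]
      calc exp (-(ρ * max t 0)) * Jf l (N Z) (max t 0) y
          ≤ exp (-(ρ * max t 0)) * exp (l * max t 0) := by gcongr; exact h.2
        _ = exp (-(ρ * max t 0) + l * max t 0) := by rw [Real.exp_add]
        _ ≤ 1 := by apply Real.exp_le_one_iff.2; nlinarith)
  have hT : ∀ Z p, T Z p = exp (-(ρ * max p.1 0)) * Jf l (N Z) (max p.1 0) p.2 := fun Z p => rfl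
  have hcon : ContractingWith (1/2) T := by
    refine ⟨by norm_num [← NNReal.coe_lt_coe], LipschitzWith.of_dist_le_mul fun Z Z' => ?_⟩
    rw [BoundedContinuousFunction.dist_le (by positivity)]
    rintro ⟨t, y⟩
    have ht : 0 ≤ max t 0 := le_max_right _ _
    rw [Real.dist_eq, hT, hT, ← mul_sub, abs_mul, abs_of_pos (exp_pos _)]
    simp only
    have hd : 0 ≤ dist Z Z' := dist_nonneg
    have key := Jf_lip (hNc Z) (hNc Z') (l := l) (ρ := ρ) (m := dist Z Z' / 2) (by positivity)
      (by
        intro s y hs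
        have := Nf_lip hk hχ c (hPc Z) (hP0 Z) (hP1 Z) (hPc Z') (hP0 Z') (hP1 Z') s y
          (exp ((ρ - l) * s) * dist Z Z') (by
            intro x
            refine (clp_lip _ _).trans ?_
            rw [← mul_sub, abs_mul, abs_of_pos (exp_pos _)]
            gcongr
            have := BoundedContinuousFunction.dist_coe_le_dist (f := Z) (g := Z') (s, x)
            rwa [Real.dist_eq] at this)
        refine this.trans (le_of_eq ?_)
        rw [hρ]; ring) ht y
    have e : exp (-(ρ * max t 0)) * exp (ρ * max t 0) = 1 := by rw [← Real.exp_add]; simp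
    calc exp (-(ρ * max t 0)) * |Jf l (N Z) (max t 0) y - Jf l (N Z') (max t 0) y|
        ≤ exp (-(ρ * max t 0)) * (dist Z Z' / 2 * exp (ρ * max t 0)) := by gcongr
      _ = (dist Z Z' / 2) := by linear_combination (dist Z Z' / 2) * e
      _ = _ := by push_cast; ring
  obtain ⟨Z, hZ⟩ : ∃ Z, T Z = Z := ⟨hcon.fixedPoint, hcon.fixedPoint_isFixedPt⟩
  let W : ℝ → ℝ → ℝ := fun t y => exp (-(l * max t 0)) * Jf l (N Z) (max t 0) y
  have hW0 : ∀ t y, 0 ≤ W t y := fun t y =>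
    mul_nonneg (exp_pos _).le (hJb Z _ y (le_max_right _ _)).1
  have hW1 : ∀ t y, W t y ≤ 1 := fun t y => by
    have h := (hJb Z (max t 0) y (le_max_right _ _)).2
    calc exp (-(l * max t 0)) * Jf l (N Z) (max t 0) y ≤ exp (-(l * max t 0)) * exp (l * max t 0) := by
          gcongr
      _ = 1 := by rw [← Real.exp_add]; simp
  have hPW : ∀ t y, 0 ≤ t → P Z t y = W t y := by
    intro t y ht
    have e : exp ((ρ - l) * t) * Z (t, y) = W t y := by
      rw [← hZ, hT]
      simp only [W, max_eq_left ht]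
      rw [← mul_assoc, ← Real.exp_add]
      ring_nf
    show clp _ = _
    rw [e, clp_eq (hW0 t y) (hW1 t y)]
  refine ⟨W, ?_, hW0, hW1, ?_, ?_⟩
  · have := hJc Z
    simp only [W]
    fun_prop
  · intro y; simp [W, Jf]
  · intro y t ht
    have h1 := (Jf_deriv (hNc Z) l t y).hasDerivWithinAt (s := Set.Ici 0)
    have e : ∀ s ∈ Set.Ici (0:ℝ), W s y = exp (-(l * s)) * Jf l (N Z) s y := by
      intro s hs
      simp only [W, max_eq_left (Set.mem_Ici.1 hs)]
    refine (h1.congr_deriv ?_).congr e (e t ht)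
    rw [← e t ht]
    simp only [N, Nf, Hf, hPW t _ ht]
    rw [hl]; ring


theorem lin_ode {Δ a b : ℝ → ℝ} (ha : Continuous a) (hb : Continuous b)
    (hd : ∀ t, 0 ≤ t → HasDerivWithinAt Δ (a t * Δ t + b t) (Set.Ici 0) t) (h0 : Δ 0 = 0)
    {t : ℝ} (ht : 0 ≤ t) :
    Δ t = exp (∫ s in (0:ℝ)..t, a s) *
      ∫ s in (0:ℝ)..t, exp (-∫ σ in (0:ℝ)..s, a σ) * b s := by
  have hI : ∀ s, HasDerivAt (fun s => ∫ σ in (0:ℝ)..s, a σ) (a s) s := fun s =>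
    intervalIntegral.integral_hasDerivAt_right (ha.intervalIntegrable _ _)
      ha.stronglyMeasurable.stronglyMeasurableAtFilter ha.continuousAt
  have hIc : Continuous (fun s => ∫ σ in (0:ℝ)..s, a σ) :=
    continuous_iff_continuousAt.2 fun s => (hI s).continuousAt
  have hE : ∀ s, HasDerivAt (fun s => exp (-∫ σ in (0:ℝ)..s, a σ))
      (exp (-∫ σ in (0:ℝ)..s, a σ) * -a s) s := fun s => (hI s).neg.exp
  have hP : ∀ s, 0 ≤ s → HasDerivWithinAt (fun s => exp (-∫ σ in (0:ℝ)..s, a σ) * Δ s)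
      (exp (-∫ σ in (0:ℝ)..s, a σ) * b s) (Set.Ici 0) s := by
    intro s hs
    exact ((hE s).hasDerivWithinAt.mul (hd s hs)).congr_deriv (by ring)
  have key := intervalIntegral.integral_eq_sub_of_hasDeriv_right (a := 0) (b := t)
    (f := fun s => exp (-∫ σ in (0:ℝ)..s, a σ) * Δ s)
    (f' := fun s => exp (-∫ σ in (0:ℝ)..s, a σ) * b s)
    (by
      intro s hs
      rw [Set.uIcc_of_le ht] at hs
      exact (hP s hs.1).continuousWithinAt.mono (by rw [Set.uIcc_of_le ht]; exact fun x hx => hx.1))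
    (by
      intro s hs
      rw [min_eq_left ht] at hs
      exact (hP s hs.1.le).mono (fun x hx => (hs.1.trans hx).le))
    (Continuous.intervalIntegrable (by fun_prop) _ _)
  rw [key, h0]
  have : exp (∫ s in (0:ℝ)..t, a s) * exp (-∫ s in (0:ℝ)..t, a s) = 1 := by
    rw [← Real.exp_add]; simp
  linear_combination (-Δ t) * this

theorem hadamard {G G' : ℝ → ℝ} (hG : ∀ y, HasDerivAt G (G' y) y) (hc : Continuous G') (y h : ℝ) :
    G (y + h) - G y = h * ∫ θ in (0:ℝ)..1, G' (y + θ * h) := by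
  have h1 : ∀ θ ∈ Set.uIcc (0:ℝ) 1, HasDerivAt (fun θ => G (y + θ * h)) (G' (y + θ * h) * h) θ := by
    intro θ _
    have hl : HasDerivAt (fun θ : ℝ => y + θ * h) h θ := by
      simpa using ((hasDerivAt_id θ).mul_const h).const_add y
    exact (hG _).comp θ hl
  have := intervalIntegral.integral_eq_sub_of_hasDerivAt h1
    (Continuous.intervalIntegrable (by fun_prop) _ _)
  rw [intervalIntegral.integral_mul_const] at this
  simp only [one_mul, zero_mul, add_zero] at this
  linarith

theorem hadamard_cont {X : Type*} [TopologicalSpace X] {F : X → ℝ → ℝ}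
    (hF : Continuous (fun p : X × ℝ => F p.1 p.2)) :
    Continuous fun x => ∫ θ in (0:ℝ)..1, F x θ :=
  intervalIntegral.continuous_parametric_intervalIntegral_of_continuous' (f := F) hF 0 1

theorem prim_cont {X : Type*} [TopologicalSpace X] {F : X → ℝ → ℝ}
    (hF : Continuous (fun p : X × ℝ => F p.1 p.2)) :
    Continuous fun p : X × ℝ => ∫ θ in (0:ℝ)..p.2, F p.1 θ :=
  intervalIntegral.continuous_parametric_primitive_of_continuous (f := F) hF

theorem W_reg {k : ℝ → ℝ} {r q L L0 : ℝ} {χ : ℝ → ℝ} (hk : H1 k) (hχ : IsH2chi r q L L0 χ)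
    (c : ℝ) {W : ℝ → ℝ → ℝ} (hW : Continuous (fun p : ℝ × ℝ => W p.1 p.2))
    (hW0 : ∀ t y, 0 ≤ W t y) (hW1 : ∀ t y, W t y ≤ 1) (hWi : ∀ y, W 0 y = 1)
    (hd : ∀ y t, 0 ≤ t → HasDerivWithinAt (fun s => W s y)
        ((∫ η, k (η - y) * W t η) - W t y + fH2 r q χ (y + -c * t) (W t y) * W t y)
        (Set.Ici 0) t) :
    ∃ D : ℝ → ℝ → ℝ, Continuous (fun p : ℝ × ℝ => D p.1 p.2) ∧
      ∀ t y, 0 ≤ t → HasDerivAt (fun y => W t y) (D t y) y := by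
  have hχ1 := hχ.2.2.2.2.1
  have hχc := hχ1.continuous
  have hχd : ∀ x, HasDerivAt χ (deriv χ x) x := fun x =>
    (hχ1.differentiable (by norm_num) x).hasDerivAt
  have hχ'c : Continuous (deriv χ) := hχ1.continuous_deriv (by norm_num)
  have hWabs : ∀ t x, |W t x| ≤ 1 := fun t x => by rw [abs_of_nonneg (hW0 t x)]; exact hW1 t x
  have hWs : ∀ t, Continuous (W t) := fun t =>
    hW.comp (by fun_prop : Continuous fun x : ℝ => (t, x))
  have hWm : ∀ {Y : Type} [TopologicalSpace Y] {u w : Y → ℝ}, Continuous u → Continuous w →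
      Continuous fun y => W (u y) (w y) := fun hu hw => hW.comp (hu.prodMk hw)
  let g' : ℝ → ℝ → ℝ := fun t y => ∫ η, (-deriv k (η - y)) * W t η
  have hg'c : Continuous (fun p : ℝ × ℝ => g' p.1 p.2) :=
    conv_cont (j := fun z => -deriv k z) (deriv_k_integrable hk).neg hW hWabs
  have hg'm : ∀ {Y : Type} [TopologicalSpace Y] {u w : Y → ℝ}, Continuous u → Continuous w →
      Continuous fun y => g' (u y) (w y) := fun hu hw => hg'c.comp (hu.prodMk hw)
  have hgd : ∀ t y, HasDerivAt (fun y => ∫ η, k (η - y) * W t η) (g' t y) y := fun t y =>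
    conv_deriv hk (hWs t).aestronglyMeasurable (hWabs t) y
  let A : ℝ × ℝ → ℝ → ℝ := fun p s => -1 + (-q + (r + q) * χ (p.1 + -c * s))
    - r * χ (p.1 + -c * s) * (W s p.1 + W s (p.1 + p.2))
  let G1 : (ℝ × ℝ) × ℝ → ℝ := fun x => ∫ θ in (0:ℝ)..1, g' x.2 (x.1.1 + θ * x.1.2)
  let G2 : (ℝ × ℝ) × ℝ → ℝ := fun x => ∫ θ in (0:ℝ)..1, deriv χ (x.1.1 + -c * x.2 + θ * x.1.2)
  have hG1 : Continuous G1 := hadamard_cont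
    (F := fun (x : (ℝ × ℝ) × ℝ) θ => g' x.2 (x.1.1 + θ * x.1.2))
    (hg'm (by fun_prop) (by fun_prop))
  have hG2 : Continuous G2 := hadamard_cont
    (F := fun (x : (ℝ × ℝ) × ℝ) θ => deriv χ (x.1.1 + -c * x.2 + θ * x.1.2))
    (hχ'c.comp (by fun_prop))
  let B : ℝ × ℝ → ℝ → ℝ := fun p s => G1 (p, s) + G2 (p, s) *
    ((r + q) * W s (p.1 + p.2) - r * W s (p.1 + p.2) ^ 2)
  have w1 : Continuous fun x : (ℝ × ℝ) × ℝ => W x.2 (x.1.1 + x.1.2) := hWm (by fun_prop) (by fun_prop)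
  have w2 : Continuous fun x : (ℝ × ℝ) × ℝ => W x.2 x.1.1 := hWm (by fun_prop) (by fun_prop)
  have hA : Continuous fun x : (ℝ × ℝ) × ℝ => A x.1 x.2 := by
    have w3 : Continuous fun x : (ℝ × ℝ) × ℝ => χ (x.1.1 + -c * x.2) := hχc.comp (by fun_prop)
    simp only [A]
    fun_prop
  have hB : Continuous fun x : (ℝ × ℝ) × ℝ => B x.1 x.2 := by
    simp only [B]
    fun_prop
  have hAs : ∀ p, Continuous (A p) := fun p =>
    hA.comp (by fun_prop : Continuous fun s : ℝ => (p, s))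
  have hBs : ∀ p, Continuous (B p) := fun p =>
    hB.comp (by fun_prop : Continuous fun s : ℝ => (p, s))
  have hIA : Continuous fun x : (ℝ × ℝ) × ℝ => ∫ σ in (0:ℝ)..x.2, A x.1 σ := prim_cont hA
  let E : (ℝ × ℝ) × ℝ → ℝ := fun x => exp (∫ s in (0:ℝ)..x.2, A x.1 s) *
      ∫ s in (0:ℝ)..x.2, exp (-∫ σ in (0:ℝ)..s, A x.1 σ) * B x.1 s
  have hEc : Continuous E := by
    have h1 : Continuous fun x : (ℝ × ℝ) × ℝ =>
        ∫ s in (0:ℝ)..x.2, exp (-∫ σ in (0:ℝ)..s, A x.1 σ) * B x.1 s :=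
      prim_cont (F := fun p s => exp (-∫ σ in (0:ℝ)..s, A p σ) * B p s) (by fun_prop)
    simp only [E]
    fun_prop
  have hE : ∀ t y h, 0 ≤ t → W t (y + h) - W t y = h * E ((y, h), t) := by
    intro t y h ht
    have := lin_ode (Δ := fun s => W s (y + h) - W s y) (hAs (y, h)) ((hBs (y, h)).const_mul h)
      (by
        intro s hs
        refine ((hd (y + h) s hs).sub (hd y s hs)).congr_deriv ?_
        have e1 := hadamard (fun y => hgd s y) (hg'c.comp (by fun_prop : Continuous fun y : ℝ => (s, y))) y h
        have e2 := hadamard hχd hχ'c (y + -c * s) h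
        have e3 : y + -c * s + h = y + h + -c * s := by ring
        rw [e3] at e2
        simp only [A, B, G1, G2, fH2]
        have e1' : (∫ η, k (η - (y + h)) * W s η) = (∫ η, k (η - y) * W s η)
          + h * ∫ θ in (0:ℝ)..1, g' s (y + θ * h) := by linarith
        have e2' : χ (y + h + -c * s) = χ (y + -c * s) +
          h * ∫ θ in (0:ℝ)..1, deriv χ (y + -c * s + θ * h) := by linarith
        rw [e1', e2']
        ring)
      (by simp [hWi]) ht
    simp only [E]
    rw [this]
    simp only [mul_left_comm _ h, intervalIntegral.integral_const_mul]
  refine ⟨fun t y => E ((y, 0), t), hEc.comp (by fun_prop :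
    Continuous fun p : ℝ × ℝ => ((p.2, (0:ℝ)), p.1)), ?_⟩
  intro t y ht
  rw [hasDerivAt_iff_tendsto_slope_zero]
  have h1 : Tendsto (fun h : ℝ => E ((y, h), t)) (𝓝[≠] 0) (𝓝 (E ((y, 0), t))) :=
    ((hEc.comp (by fun_prop : Continuous fun h : ℝ => ((y, h), t))).tendsto 0).mono_left
      nhdsWithin_le_nhds
  refine h1.congr' ?_
  filter_upwards [self_mem_nhdsWithin] with h hh
  rw [hE t y h ht, smul_eq_mul, ← mul_assoc, inv_mul_cancel₀ hh, one_mul]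

theorem exists_sol {k : ℝ → ℝ} {r q L L0 : ℝ} {χ : ℝ → ℝ} (hk : H1 k) (hχ : IsH2chi r q L L0 χ)
    (c : ℝ) : ∃ v vt vx : ℝ → ℝ → ℝ, IsClassicalSol c k (fH2 r q χ) v vt vx ∧
      (∀ ξ, v 0 ξ = 1) ∧ (∀ t ξ, 0 ≤ v t ξ) ∧ (∀ t ξ, v t ξ ≤ 1) := by
  obtain ⟨W, hW, hW0, hW1, hWi, hd⟩ := exists_W hk hχ c
  obtain ⟨D, hD, hDd⟩ := W_reg hk hχ c hW hW0 hW1 hWi hd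
  have hWabs : ∀ t x, |W t x| ≤ 1 := fun t x => by rw [abs_of_nonneg (hW0 t x)]; exact hW1 t x
  let R : ℝ → ℝ → ℝ := fun t y => (∫ η, k (η - y) * W t η) - W t y
    + fH2 r q χ (y + -c * t) (W t y) * W t y
  have hR : Continuous (fun p : ℝ × ℝ => R p.1 p.2) := by
    have h1 := conv_cont (k_integrable hk.2.2.2.1) hW hWabs
    have hχc := hχ.2.2.2.2.1.continuous
    have w3 : Continuous fun x : ℝ × ℝ => χ (x.2 + -c * x.1) := hχc.comp (by fun_prop)
    simp only [R, fH2]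
    fun_prop
  have sh : Continuous fun p : ℝ × ℝ => (p.1, p.2 + c * p.1) := by fun_prop
  have hRs : Continuous fun p : ℝ × ℝ => R p.1 (p.2 + c * p.1) := hR.comp sh
  have hDs : Continuous fun p : ℝ × ℝ => D p.1 (p.2 + c * p.1) := hD.comp sh
  refine ⟨fun t ξ => W t (ξ + c * t), fun t ξ => R t (ξ + c * t) + c * D t (ξ + c * t),
    fun t ξ => D t (ξ + c * t), ⟨⟨1, fun t ξ _ => hWabs _ _⟩, (hW.comp sh).continuousOn,
    (by fun_prop), hDs.continuousOn, ?_, ?_, ?_⟩, ?_, fun t ξ => hW0 _ _, fun t ξ => hW1 _ _⟩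
  · intro t ξ ht
    exact chain_rule (v := W) (vt := R) (vx := D) hR.continuousOn (fun t y ht => hd y t ht)
      (fun t y ht => hDd t y ht) c ξ t ht
  · intro t ξ ht
    have hl : HasDerivAt (fun y : ℝ => y + c * t) 1 ξ := by
      simpa using (hasDerivAt_id ξ).add_const (c * t)
    exact ((hDd t (ξ + c * t) ht).comp ξ hl).congr_deriv (by ring)
  · intro t ξ ht
    have e : (∫ η, k (η - ξ) * W t (η + c * t)) = ∫ η, k (η - (ξ + c * t)) * W t η := by
      rw [← integral_add_right_eq_self (fun η => k (η - (ξ + c * t)) * W t η) (c * t)]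
      congr 1; ext η; congr 2; ring
    have e2 : ξ + c * t + -c * t = ξ := by ring
    simp only [R]
    rw [e, e2]
    ring
  · intro ξ; exact hWi _


theorem shift_deriv {v vt vx : ℝ → ℝ → ℝ} {c : ℝ} {k : ℝ → ℝ} {f : ℝ → ℝ → ℝ}
    (hs : IsClassicalSol c k f v vt vx) (h : ℝ) (hh : 0 ≤ h) (y t : ℝ) (ht : 0 ≤ t) :
    HasDerivWithinAt (fun s => v (s + h) (y + -c * s))
      (vt (t + h) (y + -c * t) + -c * vx (t + h) (y + -c * t)) (Set.Ici 0) t := by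
  obtain ⟨-, -, hvt, -, hdt, hdx, -⟩ := hs
  have h1 := chain_rule hvt hdt hdx (-c) (y + c * h) (t + h) (by linarith)
  have h2 : HasDerivWithinAt (fun s : ℝ => s + h) 1 (Set.Ici 0) t :=
    ((hasDerivAt_id t).add_const h).hasDerivWithinAt
  have h3 := h1.comp t h2 (fun s hs => by
    have : (0:ℝ) ≤ s := hs
    show (0:ℝ) ≤ s + h
    linarith)
  have e : ∀ s : ℝ, y + c * h + -c * (s + h) = y + -c * s := fun s => by ring
  simp only [Function.comp_def, e, mul_one] at h3
  exact h3

theorem sol_antitone {k : ℝ → ℝ} {r q L L0 : ℝ} {χ : ℝ → ℝ} (hk : H1 k)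
    (hχ : IsH2chi r q L L0 χ) {c : ℝ} {v vt vx : ℝ → ℝ → ℝ}
    (hs : IsClassicalSol c k (fH2 r q χ) v vt vx) (hi : ∀ ξ, v 0 ξ = 1)
    (h0 : ∀ t ξ, 0 ≤ v t ξ) (h1 : ∀ t ξ, v t ξ ≤ 1) (h : ℝ) (hh : 0 ≤ h) (t ξ : ℝ) (ht : 0 ≤ t) :
    v (t + h) ξ ≤ v t ξ := by
  have habs : ∀ t x, |v t x| ≤ 1 := fun t x => by rw [abs_of_nonneg (h0 t x)]; exact h1 t x
  have hki := k_integrable hk.2.2.2.1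
  have hr := hχ.1
  have hq := hχ.2.1
  have hχ01 := hχ.2.2.2.2.2.1
  have hv := hs.2.1
  have heq := hs.2.2.2.2.2.2
  have cmp := comparison (k := k) (c := c) hk.2.1 hk.2.2.2.1
    (w := fun t ξ => v t ξ - v (t + h) ξ)
    (D := fun t ξ => vt t ξ + -c * vx t ξ - (vt (t + h) ξ + -c * vx (t + h) ξ))
    (a := fun t ξ => -1 + (-q + (r + q) * χ ξ - r * χ ξ * (v t ξ + v (t + h) ξ)))
    (A := r + q) (C := 1 + 1)
    (by
      intro t ξ _
      exact (abs_sub _ _).trans (add_le_add (habs _ _) (habs _ _)))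
    (by
      intro t ξ _
      have h4 := hχ01 ξ
      have h7 : (r + q) * χ ξ ≤ r + q := by nlinarith [h4.2]
      have h5 : 0 ≤ r * χ ξ * (v t ξ + v (t + h) ξ) :=
        mul_nonneg (mul_nonneg hr.le h4.1) (add_nonneg (h0 _ _) (h0 _ _))
      linarith)
    (by
      intro y t ht
      have e1 := shift_deriv hs 0 le_rfl y t ht
      simp only [add_zero] at e1
      exact e1.sub (shift_deriv hs h hh y t ht))
    (by
      intro t ξ ht
      have e1 := heq t ξ ht
      have e2 := heq (t + h) ξ (by linarith)
      have i1 := conv_integrable hki (g := v t) (slice_cont hv t ht).aestronglyMeasurable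
        (habs t) ξ
      have i2 := conv_integrable hki (g := v (t + h))
        (slice_cont hv (t + h) (by linarith)).aestronglyMeasurable (habs (t + h)) ξ
      simp only [mul_sub]
      rw [integral_sub i1 i2, e1, e2]
      unfold fH2
      apply le_of_eq
      ring)
    (by
      intro ξ
      rw [hi]
      linarith [h1 (0 + h) ξ])
  linarith [cmp t ξ ht]

def RV (k : ℝ → ℝ) (f : ℝ → ℝ → ℝ) (V : ℝ → ℝ) (ξ : ℝ) : ℝ :=
  (∫ η, k (η - ξ) * V η) - V ξ + f ξ (V ξ) * V ξ

theorem RV_bound {k : ℝ → ℝ} {r q L L0 : ℝ} {χ : ℝ → ℝ} (hk : H1 k)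
    (hχ : IsH2chi r q L L0 χ) {V : ℝ → ℝ} (h0 : ∀ ξ, 0 ≤ V ξ) (h1 : ∀ ξ, V ξ ≤ 1) (ξ : ℝ) :
    |RV k (fH2 r q χ) V ξ| ≤ 2 + q + r := by
  have habs : ∀ x, |V x| ≤ 1 := fun x => by rw [abs_of_nonneg (h0 x)]; exact h1 x
  have hr := hχ.1
  have hq := hχ.2.1
  obtain ⟨ha, hb⟩ := hχ.2.2.2.2.2.1 ξ
  have e1 := conv_abs hk.2.1 hk.2.2.2.1 habs ξ
  have e2 : |fH2 r q χ ξ (V ξ)| ≤ q + r := by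
    unfold fH2
    have u0 := h0 ξ
    have u1 := h1 ξ
    have b1 : 0 ≤ (r * (1 - V ξ) + q) * χ ξ := by
      have : 0 ≤ 1 - V ξ := by linarith
      positivity
    have b2 : (r * (1 - V ξ) + q) * χ ξ ≤ r + q := by
      have : r * (1 - V ξ) + q ≤ r + q := by nlinarith
      have h3 : 0 ≤ 1 - V ξ := by linarith
      have h4 : 0 ≤ r * (1 - V ξ) + q := by positivity
      nlinarith
    rw [abs_le]; constructor <;> linarith
  have e3 : |fH2 r q χ ξ (V ξ) * V ξ| ≤ q + r := by
    rw [abs_mul]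
    calc _ ≤ (q + r) * 1 := by
          gcongr
          exact habs ξ
      _ = _ := mul_one _
  unfold RV
  refine (abs_add_le _ _).trans ?_
  have := abs_sub (∫ η, k (η - ξ) * V η) (V ξ)
  linarith [habs ξ]

theorem limit_identity {k : ℝ → ℝ} {r q L L0 : ℝ} {χ : ℝ → ℝ} (hk : H1 k)
    (hχ : IsH2chi r q L L0 χ) {c : ℝ} {v vt vx : ℝ → ℝ → ℝ}
    (hs : IsClassicalSol c k (fH2 r q χ) v vt vx)
    (h0 : ∀ t ξ, 0 ≤ v t ξ) (h1 : ∀ t ξ, v t ξ ≤ 1) {V : ℝ → ℝ}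
    (hV : ∀ ξ, Tendsto (fun t => v t ξ) atTop (𝓝 (V ξ))) (ξ s : ℝ) (hs0 : 0 ≤ s) :
    V (ξ + -c * s) - V ξ = ∫ σ in (0:ℝ)..s, RV k (fH2 r q χ) V (ξ + -c * σ) := by
  have habs : ∀ t x, |v t x| ≤ 1 := fun t x => by rw [abs_of_nonneg (h0 t x)]; exact h1 t x
  have hki := k_integrable hk.2.2.2.1
  have hv := hs.2.1
  have hvt := hs.2.2.1
  have hvx := hs.2.2.2.1
  have heq := hs.2.2.2.2.2.2
  let Q : ℝ → ℝ → ℝ := fun t σ => vt (σ + t) (ξ + -c * σ) + -c * vx (σ + t) (ξ + -c * σ)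
  have hQc : ∀ t, 0 ≤ t → ContinuousOn (Q t) (Set.Ici 0) := by
    intro t ht
    have hmap : Set.MapsTo (fun σ : ℝ => (σ + t, ξ + -c * σ)) (Set.Ici 0) {p : ℝ × ℝ | 0 ≤ p.1} := by
      intro σ hσ
      have : (0:ℝ) ≤ σ := hσ
      show (0:ℝ) ≤ σ + t
      linarith
    have hc : ContinuousOn (fun σ : ℝ => (σ + t, ξ + -c * σ)) (Set.Ici 0) := by fun_prop
    have a1 := hvt.comp hc hmap
    have a2 := hvx.comp hc hmap
    exact a1.add (continuousOn_const.mul a2)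
  have hQR : ∀ t σ, 0 ≤ t → 0 ≤ σ → Q t σ = RV k (fH2 r q χ) (v (σ + t)) (ξ + -c * σ) := by
    intro t σ ht hσ
    simp only [Q, RV]
    rw [heq (σ + t) (ξ + -c * σ) (by linarith)]
    ring
  have ftc : ∀ t, 0 ≤ t → ∫ σ in (0:ℝ)..s, Q t σ = v (s + t) (ξ + -c * s) - v t ξ := by
    intro t ht
    have key := intervalIntegral.integral_eq_sub_of_hasDeriv_right (a := 0) (b := s)
      (f := fun σ => v (σ + t) (ξ + -c * σ)) (f' := Q t)
      (by
        intro σ hσ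
        rw [Set.uIcc_of_le hs0] at hσ
        exact (shift_deriv hs t ht ξ σ hσ.1).continuousWithinAt.mono
          (by rw [Set.uIcc_of_le hs0]; exact fun x hx => hx.1))
      (by
        intro σ hσ
        rw [min_eq_left hs0] at hσ
        exact (shift_deriv hs t ht ξ σ hσ.1.le).mono (fun x hx => (hσ.1.trans hx).le))
      (((hQc t ht).mono (by rw [Set.uIcc_of_le hs0]; exact fun x hx => hx.1)).intervalIntegrable)
    rw [key]
    simp
  have lim1 : Tendsto (fun t => v (s + t) (ξ + -c * s) - v t ξ) atTop
      (𝓝 (V (ξ + -c * s) - V ξ)) :=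
    ((hV (ξ + -c * s)).comp (tendsto_atTop_add_const_left atTop s tendsto_id)).sub (hV ξ)
  have limR : ∀ σ x, Tendsto (fun t => RV k (fH2 r q χ) (v (σ + t)) x) atTop
      (𝓝 (RV k (fH2 r q χ) V x)) := by
    intro σ x
    have hsh : ∀ x, Tendsto (fun t => v (σ + t) x) atTop (𝓝 (V x)) := fun x =>
      (hV x).comp (tendsto_atTop_add_const_left atTop σ tendsto_id)
    have hconv : Tendsto (fun t => ∫ η, k (η - x) * v (σ + t) η) atTop
        (𝓝 (∫ η, k (η - x) * V η)) := by
      refine tendsto_integral_filter_of_dominated_convergence (fun η => k (η - x)) ?_ ?_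
        (hki.comp_sub_right x) ?_
      · filter_upwards [eventually_ge_atTop (-σ)] with t ht
        exact (conv_integrable hki (slice_cont hv (σ + t) (by linarith)).aestronglyMeasurable
          (habs (σ + t)) x).aestronglyMeasurable
      · refine Eventually.of_forall fun t => Eventually.of_forall fun η => ?_
        rw [norm_mul, Real.norm_eq_abs, Real.norm_eq_abs, abs_of_nonneg (hk.2.1 _)]
        exact mul_le_of_le_one_right (hk.2.1 _) (habs _ _)
      · exact Eventually.of_forall fun η => (hsh η).const_mul _
    unfold RV fH2
    refine (hconv.sub (hsh x)).add (Tendsto.mul ?_ (hsh x))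
    exact (((((hsh x).const_sub 1).const_mul r).add_const q).mul_const (χ x)).const_add (-q)
  have lim2 : Tendsto (fun t => ∫ σ in (0:ℝ)..s, Q t σ) atTop
      (𝓝 (∫ σ in (0:ℝ)..s, RV k (fH2 r q χ) V (ξ + -c * σ))) := by
    refine intervalIntegral.tendsto_integral_filter_of_dominated_convergence
      (fun _ => 2 + q + r) ?_ ?_ intervalIntegrable_const ?_
    · filter_upwards [eventually_ge_atTop 0] with t ht
      refine ((hQc t ht).mono ?_).aestronglyMeasurable measurableSet_uIoc
      rw [Set.uIoc_of_le hs0]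
      exact fun x hx => hx.1.le
    · filter_upwards [eventually_ge_atTop 0] with t ht
      refine Eventually.of_forall fun σ hσ => ?_
      rw [Set.uIoc_of_le hs0] at hσ
      rw [hQR t σ ht hσ.1.le, Real.norm_eq_abs]
      exact RV_bound hk hχ (h0 _) (h1 _) _
    · refine Eventually.of_forall fun σ hσ => ?_
      rw [Set.uIoc_of_le hs0] at hσ
      refine (limR σ (ξ + -c * σ)).congr' ?_
      filter_upwards [eventually_ge_atTop 0] with t ht
      exact (hQR t σ ht hσ.1.le).symm
  refine tendsto_nhds_unique lim1 (lim2.congr' ?_)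
  filter_upwards [eventually_ge_atTop 0] with t ht
  exact ftc t ht

theorem tw_of_identity {k : ℝ → ℝ} {r q L L0 : ℝ} {χ : ℝ → ℝ} (hk : H1 k)
    (hχ : IsH2chi r q L L0 χ) {c : ℝ} (hc : 0 ≤ c) {V : ℝ → ℝ} (hVm : Measurable V)
    (hpos : ∀ ξ, 0 < V ξ) (h1 : ∀ ξ, V ξ ≤ 1)
    (hid : ∀ ξ s : ℝ, 0 ≤ s →
      V (ξ + -c * s) - V ξ = ∫ σ in (0:ℝ)..s, RV k (fH2 r q χ) V (ξ + -c * σ)) :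
    IsTW c k (fH2 r q χ) V := by
  have h0 : ∀ ξ, 0 ≤ V ξ := fun ξ => (hpos ξ).le
  have habs : ∀ x, |V x| ≤ 1 := fun x => by rw [abs_of_nonneg (h0 x)]; exact h1 x
  have hKd := conv_deriv hk hVm.aestronglyMeasurable habs
  have hKc : Continuous (fun ξ => ∫ η, k (η - ξ) * V η) :=
    continuous_iff_continuousAt.2 fun ξ => (hKd ξ).continuousAt
  have hr := hχ.1
  have hq := hχ.2.1
  have hχ1 := hχ.2.2.2.2.1
  have hχc := hχ1.continuous
  have hχ01 := hχ.2.2.2.2.2.1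
  rcases hc.eq_or_lt with hc0 | hc0
  ·
    subst hc0
    have hR : ∀ ξ, RV k (fH2 r q χ) V ξ = 0 := by
      intro ξ
      have := hid ξ 1 zero_le_one
      simpa using this.symm
    let K : ℝ → ℝ := fun ξ => ∫ η, k (η - ξ) * V η
    let b : ℝ → ℝ := fun ξ => 1 + q - (r + q) * χ ξ
    have hquad : ∀ ξ, K ξ = V ξ * (b ξ + r * χ ξ * V ξ) := by
      intro ξ
      have := hR ξ
      simp only [RV, fH2] at this
      simp only [K, b]
      linarith
    have hKpos : ∀ ξ, 0 < K ξ := by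
      intro ξ
      have hi := conv_integrable (k_integrable hk.2.2.2.1) hVm.aestronglyMeasurable habs ξ
      refine (integral_pos_iff_support_of_nonneg
        (fun η => mul_nonneg (hk.2.1 _) (h0 _)) hi).2 ?_
      have ho : IsOpen {η : ℝ | 0 < k (η - ξ)} :=
        isOpen_lt continuous_const (hk.1.continuous.comp (by fun_prop))
      have hne : ({η : ℝ | 0 < k (η - ξ)}).Nonempty := ⟨ξ, by simpa using hk.2.2.2.2.1⟩
      refine lt_of_lt_of_le (ho.measure_pos volume hne) (measure_mono ?_)
      intro η hη
      exact (mul_pos hη (hpos η)).ne'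
    let S : ℝ → ℝ := fun ξ => b ξ ^ 2 + 4 * (r * χ ξ) * K ξ
    have hSeq : ∀ ξ, S ξ = (b ξ + 2 * (r * χ ξ) * V ξ) ^ 2 := by
      intro ξ
      simp only [S]; rw [hquad ξ]; ring
    have hbp : ∀ ξ, 0 < b ξ + r * χ ξ * V ξ := by
      intro ξ
      have := hKpos ξ
      rw [hquad ξ] at this
      exact (pos_iff_pos_of_mul_pos this).1 (hpos ξ)
    have hbp2 : ∀ ξ, 0 < b ξ + 2 * (r * χ ξ) * V ξ := by
      intro ξ
      have h3 : 0 ≤ r * χ ξ * V ξ := mul_nonneg (mul_nonneg hr.le (hχ01 ξ).1) (h0 ξ)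
      linarith [hbp ξ]
    have hsq : ∀ ξ, √(S ξ) = b ξ + 2 * (r * χ ξ) * V ξ := by
      intro ξ
      rw [hSeq, Real.sqrt_sq (hbp2 ξ).le]
    have hVf : V = fun ξ => 2 * K ξ / (b ξ + √(S ξ)) := by
      ext ξ
      rw [hsq, hquad]
      have := hbp ξ
      rw [eq_div_iff (by linarith)]
      ring
    have hKc : Continuous K := hKc
    have hbc : Continuous b := by simp only [b]; fun_prop
    have hVc : Continuous V := by
      rw [hVf]
      refine Continuous.div (by fun_prop) (by fun_prop) ?_
      intro ξ
      rw [hsq]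
      linarith [hbp ξ]
    have hK1 : ContDiff ℝ 1 K := by
      rw [contDiff_one_iff_deriv]
      refine ⟨fun ξ => (hKd ξ).differentiableAt, ?_⟩
      have e : deriv K = fun ξ => ∫ η, (-deriv k (η - ξ)) * V η := by
        ext ξ; exact (hKd ξ).deriv
      rw [e]
      have := conv_cont (j := fun z => -deriv k z) (deriv_k_integrable hk).neg
        (P := fun _ x => V x) (C := 1) (by fun_prop) (fun _ x => habs x)
      exact this.comp (by fun_prop : Continuous fun ξ : ℝ => ((0:ℝ), ξ))
    have hb1 : ContDiff ℝ 1 b := by simp only [b]; fun_prop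
    have hS1 : ContDiff ℝ 1 S := by simp only [S]; fun_prop
    refine ⟨?_, hpos, ⟨1, h1⟩, ?_⟩
    · rw [hVf]
      refine ContDiff.div (by fun_prop) (hb1.add (hS1.sqrt ?_)) ?_
      · intro ξ
        rw [hSeq]
        exact (pow_pos (hbp2 ξ) 2).ne'
      · intro ξ
        rw [hsq]
        linarith [hbp ξ]
    · intro ξ
      have := hR ξ
      unfold RV at this
      rw [zero_mul, zero_add]
      exact this
  ·
    have hlip : LipschitzWith (Real.toNNReal ((2 + q + r) / c)) V := by
      refine LipschitzWith.of_le_add_mul' _ ?_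
      have hb : ∀ x y, y ≤ x → |V y - V x| ≤ (2 + q + r) / c * |x - y| := by
        intro x y hxy
        have hsn : 0 ≤ (x - y) / c := div_nonneg (by linarith) hc0.le
        have e : x + -c * ((x - y) / c) = y := by field_simp; ring
        have := hid x ((x - y) / c) hsn
        rw [e] at this
        rw [this, ← Real.norm_eq_abs]
        refine (intervalIntegral.norm_integral_le_of_norm_le_const
          (C := 2 + q + r) (fun σ _ => ?_)).trans (le_of_eq ?_)
        · rw [Real.norm_eq_abs]; exact RV_bound hk hχ h0 h1 _
        · rw [sub_zero, abs_div, abs_of_pos hc0]; ring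
      intro x y
      rw [Real.dist_eq]
      rcases le_total y x with hxy | hxy
      · have := (abs_le.1 (hb x y hxy)).1
        linarith
      · have := (abs_le.1 (hb y x hxy)).2
        rw [abs_sub_comm]
        linarith
    have hVc : Continuous V := hlip.continuous
    have hRc : Continuous (RV k (fH2 r q χ) V) := by
      unfold RV fH2
      fun_prop
    have hd : ∀ ξ, HasDerivAt V (-(RV k (fH2 r q χ) V ξ) / c) ξ := by
      intro ξ0
      set b := ξ0 + 1 with hb
      have hgc : Continuous fun σ => RV k (fH2 r q χ) V (b + -c * σ) := hRc.comp (by fun_prop)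
      have hl : HasDerivAt (fun x : ℝ => (b - x) / c) (-1 / c) ξ0 :=
        ((hasDerivAt_id ξ0).const_sub b).div_const c
      have hI : HasDerivAt (fun s => ∫ σ in (0:ℝ)..s, RV k (fH2 r q χ) V (b + -c * σ))
          (RV k (fH2 r q χ) V (b + -c * ((b - ξ0) / c))) ((b - ξ0) / c) :=
        intervalIntegral.integral_hasDerivAt_right (hgc.intervalIntegrable _ _)
          hgc.stronglyMeasurable.stronglyMeasurableAtFilter hgc.continuousAt
      have e : ∀ x, b + -c * ((b - x) / c) = x := fun x => by field_simp; ring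
      rw [e ξ0] at hI
      have h2 := ((hI.comp ξ0 hl).const_add (V b))
      refine (h2.congr_of_eventuallyEq ?_).congr_deriv (by ring)
      have : Set.Iio b ∈ 𝓝 ξ0 := Iio_mem_nhds (by rw [hb]; linarith)
      filter_upwards [this] with x hx
      have hx' : x < b := hx
      have := hid b ((b - x) / c) (div_nonneg (by linarith) hc0.le)
      rw [e x] at this
      simp only [Function.comp_apply]
      linarith
    have hderiv : deriv V = fun ξ => -(RV k (fH2 r q χ) V ξ) / c := by
      ext ξ; exact (hd ξ).deriv
    refine ⟨?_, hpos, ⟨1, h1⟩, ?_⟩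
    · rw [contDiff_one_iff_deriv]
      refine ⟨fun ξ => (hd ξ).differentiableAt, ?_⟩
      rw [hderiv]
      fun_prop
    · intro ξ
      rw [hderiv]
      simp only [RV]
      field_simp
      ring

theorem dir12 (k : ℝ → ℝ) (hk : H1 k)
    (r q L L0 : ℝ) (χ : ℝ → ℝ) (hχ : IsH2chi r q L L0 χ)
    (c : ℝ) (hc : 0 ≤ c) (hper : ∀ u₀ : ℝ → ℝ, UniformContinuous u₀ → (∃ C, ∀ ξ, u₀ ξ ≤ C) →
        (∀ ξ, 0 ≤ u₀ ξ) →
        (∃ δ > 0, ∀ ξ, δ ≤ u₀ ξ) →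
        ∀ v vt vx, IsClassicalSol c k (fH2 r q χ) v vt vx → (∀ ξ, v 0 ξ = u₀ ξ) →
          ∀ K > 0, ∃ δ > 0, ∃ T : ℝ, ∀ t ≥ T, ∀ ξ : ℝ, |ξ| ≤ K → δ ≤ v t ξ) :
    ∃ Φ, IsTW c k (fH2 r q χ) Φ := by
  obtain ⟨v, vt, vx, hs, hi, h0, h1⟩ := exists_sol hk hχ c
  have hp := hper (fun _ => 1) uniformContinuous_const ⟨1, fun _ => le_rfl⟩
    (fun _ => zero_le_one) ⟨1, one_pos, fun _ => le_rfl⟩ v vt vx hs hi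
  let V : ℝ → ℝ := fun ξ => ⨅ t : ℝ, v (max t 0) ξ
  have hV' : ∀ ξ, Tendsto (fun t => v (max t 0) ξ) atTop (𝓝 (V ξ)) := by
    intro ξ
    refine tendsto_atTop_ciInf ?_ ⟨0, ?_⟩
    · intro s t hst
      have := sol_antitone hk hχ hs hi h0 h1 (max t 0 - max s 0)
        (sub_nonneg.2 (max_le_max_right 0 hst)) (max s 0) ξ (le_max_right _ _)
      simpa using this
    · rintro _ ⟨t, rfl⟩
      exact h0 _ _
  have hV : ∀ ξ, Tendsto (fun t => v t ξ) atTop (𝓝 (V ξ)) := by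
    intro ξ
    refine (hV' ξ).congr' ?_
    filter_upwards [eventually_ge_atTop 0] with t ht
    rw [max_eq_left ht]
  have hVm : Measurable V := by
    refine measurable_of_tendsto_metrizable' (f := fun (t : ℝ) ξ => v (max t 0) ξ) atTop
      (fun t => (slice_cont hs.2.1 (max t 0) (le_max_right _ _)).measurable) ?_
    exact tendsto_pi_nhds.2 hV'
  refine ⟨V, tw_of_identity hk hχ hc hVm ?_ ?_ (limit_identity hk hχ hs h0 h1 hV)⟩
  · intro ξ
    obtain ⟨δ, hδ, T, hT⟩ := hp (|ξ| + 1) (by positivity)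
    refine lt_of_lt_of_le hδ (ge_of_tendsto (hV ξ) ?_)
    filter_upwards [eventually_ge_atTop T] with t ht
    exact hT t ht ξ (by linarith)
  · intro ξ
    exact le_of_tendsto' (hV ξ) (fun t => h1 t ξ)

/-- Equivalence of persistence and existence of traveling waves. -/
theorem persistence_iff_traveling_wave
    (k : ℝ → ℝ) (hk : H1 k)
    (r q L L0 : ℝ) (χ : ℝ → ℝ) (hχ : IsH2chi r q L L0 χ)
    (c : ℝ) (hc : 0 ≤ c) :
    (∀ u₀ : ℝ → ℝ, UniformContinuous u₀ → (∃ C, ∀ ξ, u₀ ξ ≤ C) → (∀ ξ, 0 ≤ u₀ ξ) →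
        (∃ δ > 0, ∀ ξ, δ ≤ u₀ ξ) →
        ∀ v vt vx, IsClassicalSol c k (fH2 r q χ) v vt vx → (∀ ξ, v 0 ξ = u₀ ξ) →
          ∀ K > 0, ∃ δ > 0, ∃ T : ℝ, ∀ t ≥ T, ∀ ξ : ℝ, |ξ| ≤ K → δ ≤ v t ξ) ↔
      (∃ Φ, IsTW c k (fH2 r q χ) Φ) := by

  constructor
  · intro h
    exact dir12 k hk r q L L0 χ hχ c hc h
  · rintro ⟨Φ, hΦ⟩
    exact dir21 k hk r q L L0 χ hχ c Φ hΦ
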